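/- Let n ≥ 1 and let 1 ≤ l ≤ n, and set k = n mod l, assuming k ≥ 1. Suppose that every ℝ-linear map Ψ : B_H → B_H that maps P_k bijectively onto itself is of Wigner form. Then every ℝ-linear map Φ : B_H → B_H that maps P_l bijectively onto itself is of Wigner form. -/

import Mathlib

open Matrix

noncomputable section

/-- `BH n` is the real vector space of `n × n` complex Hermitian (self-adjoint) matrices. -/
abbrev BH (n : ℕ) := selfAdjoint (Matrix (Fin n) (Fin n) ℂ)

/-- `projSet n k` is the set of rank-`k` Hermitian projections, viewed inside `BH n`. -/
def projSet (n k : ℕ) : Set (BH n) :=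
  {P | (P : Matrix (Fin n) (Fin n) ℂ) * (P : Matrix (Fin n) (Fin n) ℂ) = (P : Matrix (Fin n) (Fin n) ℂ)
    ∧ (P : Matrix (Fin n) (Fin n) ℂ).rank = k}

/-- A map is of Wigner form if it is `X ↦ U X U†` or `X ↦ U Xᵀ U†` for some unitary `U`. -/
def WignerForm (n : ℕ) (Φ : BH n →ₗ[ℝ] BH n) : Prop :=
  ∃ U ∈ Matrix.unitaryGroup (Fin n) ℂ,
    (∀ X : BH n, (Φ X : Matrix (Fin n) (Fin n) ℂ) = U * (X : Matrix (Fin n) (Fin n) ℂ) * Uᴴ) ∨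
    (∀ X : BH n, (Φ X : Matrix (Fin n) (Fin n) ℂ) = U * (X : Matrix (Fin n) (Fin n) ℂ)ᵀ * Uᴴ)

/-- Matrix-level description of rank-`k` Hermitian projections. -/
def IsPr (n k : ℕ) (A : Matrix (Fin n) (Fin n) ℂ) : Prop :=
  Aᴴ = A ∧ A * A = A ∧ A.trace = (k : ℂ)

theorem rank_of_idem {n : ℕ} (A : Matrix (Fin n) (Fin n) ℂ) (h : A * A = A) :
    A.trace = (A.rank : ℂ) := by
  have hp : LinearMap.IsProj (LinearMap.range (Matrix.toLin' A)) (Matrix.toLin' A) := by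
    refine ⟨fun x => LinearMap.mem_range_self _ x, ?_⟩
    rintro _ ⟨y, rfl⟩
    rw [← LinearMap.comp_apply, ← Matrix.toLin'_mul, h]
  have := hp.trace
  rw [Matrix.trace_toLin'_eq] at this
  rw [this]
  rfl

theorem mem_projSet_iff {n k : ℕ} (X : BH n) :
    X ∈ projSet n k ↔ IsPr n k (X : Matrix (Fin n) (Fin n) ℂ) := by
  constructor
  · rintro ⟨h1, h2⟩
    exact ⟨X.2, h1, by rw [rank_of_idem _ h1, h2]⟩
  · rintro ⟨_, h1, h2⟩
    refine ⟨h1, ?_⟩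
    rw [rank_of_idem _ h1] at h2
    exact_mod_cast h2

theorem isPr_conj_diag {n : ℕ} (U : Matrix (Fin n) (Fin n) ℂ) (hU : star U * U = 1)
    (S : Finset (Fin n)) :
    IsPr n S.card (U * diagonal (fun i => if i ∈ S then (1 : ℂ) else 0) * star U) := by
  refine ⟨?_, ?_, ?_⟩
  · simp only [← star_eq_conjTranspose, star_mul, star_star]
    rw [star_eq_conjTranspose (diagonal _), diagonal_conjTranspose, ← mul_assoc]
    congr 3
    ext i
    simp only [Pi.star_apply]
    split_ifs <;> simp
  · rw [show ∀ D : Matrix (Fin n) (Fin n) ℂ, U * D * star U * (U * D * star U)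
      = U * (D * ((star U * U) * D)) * star U from fun D => by simp only [mul_assoc], hU, one_mul,
      diagonal_mul_diagonal]
    congr 3
    ext i
    split_ifs <;> simp
  · rw [trace_mul_comm, ← mul_assoc, hU, one_mul, trace_diagonal]
    simp

theorem split_pr {n a b : ℕ} {A : Matrix (Fin n) (Fin n) ℂ} (hA : IsPr n (a + b) A) :
    ∃ B C, IsPr n a B ∧ IsPr n b C ∧ A = B + C ∧ (B * C).trace = 0 := by
  obtain ⟨h1, h2, h3⟩ := hA
  have hH : A.IsHermitian := h1
  set U : Matrix (Fin n) (Fin n) ℂ := (hH.eigenvectorUnitary : Matrix (Fin n) (Fin n) ℂ) with hUdef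
  have hU : star U * U = 1 := Unitary.coe_star_mul_self _
  have hspec : A = U * diagonal (fun i => (hH.eigenvalues i : ℂ)) * star U := by
    have := hH.spectral_theorem
    rw [Unitary.conjStarAlgAut_apply] at this
    exact this
  have hD : diagonal (fun i => (hH.eigenvalues i : ℂ)) = star U * A * U := by
    conv_rhs => rw [hspec]
    rw [show ∀ D : Matrix (Fin n) (Fin n) ℂ, star U * (U * D * star U) * U
      = (star U * U) * D * (star U * U) from fun D => by simp only [mul_assoc], hU, one_mul, mul_one]
  have hU' : U * star U = 1 := mul_eq_one_comm.mp hU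
  have hDD : diagonal (fun i => (hH.eigenvalues i : ℂ)) * diagonal (fun i => (hH.eigenvalues i : ℂ))
      = diagonal (fun i => (hH.eigenvalues i : ℂ)) := by
    rw [hD, show star U * A * U * (star U * A * U) = star U * (A * (U * star U) * A) * U by
      simp only [mul_assoc], hU', mul_one, h2]
  have hev : ∀ i, hH.eigenvalues i = 0 ∨ hH.eigenvalues i = 1 := by
    intro i
    have := congrFun (congrFun hDD i) i
    rw [diagonal_mul_diagonal, diagonal_apply_eq, diagonal_apply_eq] at this
    have h : hH.eigenvalues i * hH.eigenvalues i = hH.eigenvalues i := by exact_mod_cast this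
    rcases eq_or_ne (hH.eigenvalues i) 0 with h0 | h0
    · exact Or.inl h0
    · exact Or.inr (mul_left_cancel₀ h0 (by rw [h, mul_one]))
  set T : Finset (Fin n) := Finset.univ.filter (fun i => hH.eigenvalues i = 1) with hT
  have hDT : diagonal (fun i => (hH.eigenvalues i : ℂ))
      = diagonal (fun i => if i ∈ T then (1 : ℂ) else 0) := by
    congr 1
    ext i
    rcases hev i with h | h <;> simp [hT, h]
  rw [hDT] at hspec
  have hcard : T.card = a + b := by
    have := (isPr_conj_diag U hU T).2.2
    rw [← hspec, h3] at this
    exact_mod_cast this.symm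
  obtain ⟨S, hST, hS⟩ := Finset.exists_subset_card_eq (s := T) (n := a) (by omega)
  refine ⟨_, U * diagonal (fun i => if i ∈ T \ S then (1 : ℂ) else 0) * star U,
    hS ▸ isPr_conj_diag U hU S, ?_, ?_, ?_⟩
  · have := isPr_conj_diag U hU (T \ S)
    rwa [Finset.card_sdiff_of_subset hST, hcard, hS, Nat.add_sub_cancel_left] at this
  · rw [hspec, ← add_mul, ← mul_add, diagonal_add]
    congr 3
    ext i
    by_cases h : i ∈ S
    · simp [h, hST h]
    · simp [h]
  · rw [show ∀ D E : Matrix (Fin n) (Fin n) ℂ, U * D * star U * (U * E * star U)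
      = U * (D * ((star U * U) * E)) * star U from fun D E => by simp only [mul_assoc], hU, one_mul,
      diagonal_mul_diagonal]
    have : (fun i => (if i ∈ S then (1 : ℂ) else 0) * (if i ∈ T \ S then (1 : ℂ) else 0)) = 0 := by
      ext i
      by_cases h : i ∈ S <;> simp [h]
    rw [this]
    simp

open scoped ComplexOrder in
theorem pr_add {n a b : ℕ} {B C : Matrix (Fin n) (Fin n) ℂ} (hB : IsPr n a B) (hC : IsPr n b C)
    (h : (B * C).trace = 0) : IsPr n (a + b) (B + C) := by
  have h0 : B * C = 0 := by
    rw [← trace_conjTranspose_mul_self_eq_zero_iff, conjTranspose_mul, hB.1, hC.1,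
      show C * B * (B * C) = C * ((B * B) * C) by simp only [mul_assoc], hB.2.1, trace_mul_comm,
      mul_assoc, hC.2.1, h]
  have h0' : C * B = 0 := by
    have := congrArg conjTranspose h0
    rwa [conjTranspose_mul, hB.1, hC.1, conjTranspose_zero] at this
  refine ⟨?_, ?_, ?_⟩
  · rw [conjTranspose_add, hB.1, hC.1]
  · rw [add_mul, mul_add, mul_add, h0, h0', hB.2.1, hC.2.1]; simp
  · rw [trace_add, hB.2.2, hC.2.2]; push_cast; rfl

theorem pr_compl {n a b : ℕ} (hab : a + b = n) {B : Matrix (Fin n) (Fin n) ℂ} (hB : IsPr n a B) :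
    IsPr n b (1 - B) := by
  refine ⟨?_, ?_, ?_⟩
  · rw [conjTranspose_sub, hB.1, conjTranspose_one]
  · rw [sub_mul, mul_sub, mul_sub, hB.2.1]; simp
  · rw [trace_sub, hB.2.2, trace_one, Fintype.card_fin, ← hab]; push_cast; ring

theorem comb_sum {n l : ℕ} (hl1 : 1 ≤ l) (hln : l < n) (b : Fin n → Fin n → ℝ)
    (hb : ∀ S : Finset (Fin n), S.card = l → ∑ i ∈ S, ∑ j ∈ S, b i j = 0)
    (htot : 0 ≤ ∑ i, ∑ j, b i j) : ∑ i, b i i ≤ 0 := by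
  obtain ⟨S, -, hS⟩ := Finset.exists_subset_card_eq (s := (Finset.univ : Finset (Fin n))) (n := l)
    (by simp; omega)
  obtain ⟨i0, hi0⟩ : S.Nonempty := by rw [← Finset.card_pos]; omega
  obtain ⟨j0, hj0⟩ : ∃ j, j ∉ S := by
    by_contra! h
    have : S = Finset.univ := Finset.eq_univ_iff_forall.mpr h
    rw [this] at hS; simp at hS; omega
  have hij0 : i0 ≠ j0 := fun h => hj0 (h ▸ hi0)
  let c : Fin n → ℝ := fun i => if i ∈ S then 1 else 0
  let N : Fin n → Fin n → ℝ := fun i j => ∑ σ : Equiv.Perm (Fin n), c (σ i) * c (σ j)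
  have hNinv : ∀ (τ : Equiv.Perm (Fin n)) i j, N (τ i) (τ j) = N i j := by
    intro τ i j
    exact Equiv.sum_comp (Equiv.mulRight τ) (fun σ : Equiv.Perm (Fin n) => c (σ i) * c (σ j))
  have hNd : ∀ i, N i i = N i0 i0 := by
    intro i
    have := hNinv (Equiv.swap i i0) i i
    simpa using this.symm
  have hNo : ∀ i j, i ≠ j → N i j = N i0 j0 := by
    intro i j hij
    have := hNinv (Equiv.swap (Equiv.swap i i0 j) j0 * Equiv.swap i i0) i j
    rw [← this]
    congr 1
    · simp only [Equiv.Perm.mul_apply, Equiv.swap_apply_left]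
      refine Equiv.swap_apply_of_ne_of_ne ?_ hij0
      intro h
      have h2 : Equiv.swap i i0 i = Equiv.swap i i0 j := by rw [← h, Equiv.swap_apply_left]
      exact hij ((Equiv.swap i i0).injective h2)
    · simp only [Equiv.Perm.mul_apply, Equiv.swap_apply_left]
  have hb0 : 0 ≤ N i0 j0 := by
    apply Finset.sum_nonneg
    intro σ _
    simp only [c]
    split_ifs <;> simp
  have ha : 0 < N i0 i0 - N i0 j0 := by
    simp only [N, ← Finset.sum_sub_distrib]
    apply Finset.sum_pos'
    · intro σ _
      simp only [c]
      split_ifs <;> simp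
    · exact ⟨1, Finset.mem_univ _, by simp [c, hi0, hj0]⟩
  have hsum : ∑ i, ∑ j, N i j * b i j = 0 := by
    have h1 : ∀ σ : Equiv.Perm (Fin n), ∑ i, ∑ j, c (σ i) * c (σ j) * b i j = 0 := by
      intro σ
      rw [← hb (Finset.univ.filter (fun i => σ i ∈ S)) _]
      · rw [Finset.sum_filter]
        apply Finset.sum_congr rfl
        intro i _
        rw [Finset.sum_filter]
        by_cases h : σ i ∈ S <;> simp [c, h]
      · rw [← hS]
        have : Finset.univ.filter (fun i => σ i ∈ S) = S.map σ.symm.toEmbedding := by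
          ext i; simp [Finset.mem_map_equiv]
        rw [this, Finset.card_map]
    calc ∑ i, ∑ j, N i j * b i j
        = ∑ i, ∑ j, ∑ σ : Equiv.Perm (Fin n), c (σ i) * c (σ j) * b i j := by
          simp only [N, Finset.sum_mul]
      _ = ∑ i, ∑ σ : Equiv.Perm (Fin n), ∑ j, c (σ i) * c (σ j) * b i j := by
          apply Finset.sum_congr rfl; intro i _; exact Finset.sum_comm
      _ = ∑ σ : Equiv.Perm (Fin n), ∑ i, ∑ j, c (σ i) * c (σ j) * b i j := Finset.sum_comm
      _ = 0 := Finset.sum_eq_zero (fun σ _ => h1 σ)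
  have hsum2 : ∑ i, ∑ j, N i j * b i j
      = (N i0 i0 - N i0 j0) * ∑ i, b i i + N i0 j0 * ∑ i, ∑ j, b i j := by
    have : ∀ i j, N i j * b i j
        = (if i = j then (N i0 i0 - N i0 j0) * b i j else 0) + N i0 j0 * b i j := by
      intro i j
      split_ifs with h
      · subst h; rw [hNd i]; ring
      · rw [hNo i j h]; ring
    simp only [this, Finset.sum_add_distrib, Finset.mul_sum]
    simp
  rw [hsum] at hsum2
  by_contra! hpos
  have := mul_pos ha hpos
  have := mul_nonneg hb0 htot
  linarith

theorem isPr_diag {n : ℕ} (S : Finset (Fin n)) :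
    IsPr n S.card (∑ i ∈ S, single i i (1 : ℂ)) := by
  have h := isPr_conj_diag (1 : Matrix (Fin n) (Fin n) ℂ) (by simp) S
  have : (∑ i ∈ S, single i i (1 : ℂ)) = diagonal (fun i => if i ∈ S then (1 : ℂ) else 0) := by
    ext a b
    simp only [Matrix.sum_apply, single_apply, diagonal_apply]
    rcases eq_or_ne a b with rfl | hab
    · simp
    · rw [if_neg hab]
      apply Finset.sum_eq_zero
      intro i _
      rw [if_neg]
      rintro ⟨rfl, rfl⟩
      exact hab rfl
  rw [this]
  simpa using h

theorem isPr_rot {n : ℕ} (i j : Fin n) (hij : i ≠ j) (z : ℂ) (hz : star z * z = 1) :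
    IsPr n 1 ((1 / 2 : ℂ) • (single i i 1 + single j j 1) +
      (1 / 2 : ℂ) • (z • single i j 1 + star z • single j i 1)) := by
  have hz' : z * star z = 1 := by rw [mul_comm]; exact hz
  refine ⟨?_, ?_, ?_⟩
  · simp [conjTranspose_add, add_comm]
  · have h1 : 1 / 2 * z * (1 / 2 * star z) = (1 / 4 : ℂ) := by linear_combination (1 / 4) * hz'
    have h2 : 1 / 2 * star z * (1 / 2 * z) = (1 / 4 : ℂ) := by linear_combination (1 / 4) * hz
    simp only [add_mul, mul_add, smul_add, single_mul_single_same, smul_mul_assoc,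
      mul_smul_comm, single_mul_single_of_ne _ _ _ _ hij,
      single_mul_single_of_ne _ _ _ _ hij.symm, smul_smul, smul_zero, mul_one,
      add_zero, zero_add, h1, h2]
    module
  · simp [trace_add, hij, hij.symm]
    norm_num

theorem isPr_rot_add {n : ℕ} (S : Finset (Fin n)) (i j : Fin n) (hi : i ∉ S) (hj : j ∉ S)
    (hij : i ≠ j) (z : ℂ) (hz : star z * z = 1) :
    IsPr n (S.card + 1) (∑ k ∈ S, single k k (1 : ℂ) +
      ((1 / 2 : ℂ) • (single i i 1 + single j j 1) +
      (1 / 2 : ℂ) • (z • single i j 1 + star z • single j i 1))) := by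
  apply pr_add (isPr_diag S) (isPr_rot i j hij z hz)
  rw [Finset.sum_mul, trace_sum]
  apply Finset.sum_eq_zero
  intro k hk
  have h1 : k ≠ i := fun h => hi (h ▸ hk)
  have h2 : k ≠ j := fun h => hj (h ▸ hk)
  simp [mul_add, h1, h2]

theorem exists_avoid {n l : ℕ} (hl1 : 1 ≤ l) (hln : l < n) (i j : Fin n) (hij : i ≠ j) :
    ∃ S : Finset (Fin n), i ∉ S ∧ j ∉ S ∧ S.card + 1 = l := by
  obtain ⟨S, hS, hc⟩ := Finset.exists_subset_card_eq
    (s := (Finset.univ \ {i, j} : Finset (Fin n))) (n := l - 1) (by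
      rw [Finset.card_sdiff_of_subset (Finset.subset_univ _), Finset.card_pair hij]; simp; omega)
  refine ⟨S, fun h => ?_, fun h => ?_, by omega⟩
  · simpa using hS h
  · simpa using hS h

theorem span_pr {n l : ℕ} (hl1 : 1 ≤ l) (hln : l < n) :
    Submodule.span ℂ {A : Matrix (Fin n) (Fin n) ℂ | IsPr n l A} = ⊤ := by
  set V := Submodule.span ℂ {A : Matrix (Fin n) (Fin n) ℂ | IsPr n l A} with hV
  have hmem : ∀ A, IsPr n l A → A ∈ V := fun A hA => Submodule.subset_span hA
  have hoff : ∀ i j : Fin n, i ≠ j → single i j (1 : ℂ) ∈ V := by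
    intro i j hij
    obtain ⟨S, hi, hj, hc⟩ := exists_avoid hl1 hln i j hij
    have key : ∀ z : ℂ, star z * z = 1 → z • single i j 1 + star z • single j i 1 ∈ V := by
      intro z hz
      have h1 := hmem _ (hc ▸ isPr_rot_add S i j hi hj hij z hz)
      have h2 := hmem _ (hc ▸ isPr_rot_add S i j hi hj hij (-z) (by simpa using hz))
      have h3 := V.sub_mem h1 h2
      convert h3 using 1
      rw [star_neg]
      module
    have h1 := key 1 (by simp)
    have h2 := key Complex.I (by simp)
    have h3 := V.smul_mem (1 / 2 : ℂ) (V.sub_mem h1 (V.smul_mem Complex.I h2))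
    convert h3 using 1
    rw [show star Complex.I = - Complex.I from Complex.conj_I]
    simp only [smul_add, smul_smul, star_one, smul_sub, mul_neg, Complex.I_mul_I]
    module
  have hdd : ∀ i j : Fin n, i ≠ j → single i i (1 : ℂ) - single j j 1 ∈ V := by
    intro i j hij
    obtain ⟨S, hi, hj, hc⟩ := exists_avoid hl1 hln i j hij
    have h1 := hmem _ (hc ▸ (Finset.card_insert_of_notMem hi) ▸ isPr_diag (insert i S))
    have h2 := hmem _ (hc ▸ (Finset.card_insert_of_notMem hj) ▸ isPr_diag (insert j S))
    have h3 := V.sub_mem h1 h2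
    rw [Finset.sum_insert hi, Finset.sum_insert hj] at h3
    convert h3 using 1
    abel
  have hd : ∀ i : Fin n, single i i (1 : ℂ) ∈ V := by
    intro i
    obtain ⟨S, hS⟩ := Finset.exists_subset_card_eq (s := (Finset.univ : Finset (Fin n))) (n := l)
      (by simp; omega)
    have h1 := hmem _ (hS.2 ▸ isPr_diag S)
    have h2 : ∑ k ∈ S, (single i i (1 : ℂ) - single k k 1) ∈ V := by
      apply V.sum_mem
      intro k _
      rcases eq_or_ne i k with rfl | h
      · simp
      · exact hdd i k h
    have h3 := V.add_mem h1 h2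
    rw [Finset.sum_sub_distrib, add_sub_cancel, Finset.sum_const, hS.2] at h3
    have h4 := V.smul_mem ((l : ℂ)⁻¹) h3
    rw [← Nat.cast_smul_eq_nsmul ℂ, smul_smul, inv_mul_cancel₀ (by
      exact_mod_cast (by omega : l ≠ 0)), one_smul] at h4
    exact h4
  rw [eq_top_iff]
  rintro A -
  rw [matrix_eq_sum_single A]
  apply V.sum_mem
  intro i _
  apply V.sum_mem
  intro j _
  have : single i j (A i j) = A i j • single i j (1 : ℂ) := by simp
  rw [this]
  apply V.smul_mem
  rcases eq_or_ne i j with rfl | h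
  · exact hd i
  · exact hoff i j h

theorem trace_pres {n l : ℕ} (hl1 : 1 ≤ l) (hln : l < n)
    (L : Matrix (Fin n) (Fin n) ℂ →ₗ[ℂ] Matrix (Fin n) (Fin n) ℂ)
    (hL : ∀ A, IsPr n l A → IsPr n l (L A)) (A : Matrix (Fin n) (Fin n) ℂ) :
    (L A).trace = A.trace := by
  have h : (traceLinearMap (Fin n) ℂ ℂ).comp L = traceLinearMap (Fin n) ℂ ℂ := by
    apply LinearMap.ext_on (span_pr hl1 hln)
    intro A hA
    simp only [LinearMap.comp_apply, traceLinearMap_apply]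
    rw [(hL A hA).2.2, hA.2.2]
  exact LinearMap.congr_fun h A

/-- The real inner product on complex matrices. -/
def ip {n : ℕ} (A B : Matrix (Fin n) (Fin n) ℂ) : ℝ := (Aᴴ * B).trace.re

theorem ip_eq {n : ℕ} (A B : Matrix (Fin n) (Fin n) ℂ) :
    ip A B = ∑ j, ∑ i, ((A i j).re * (B i j).re + (A i j).im * (B i j).im) := by
  simp [ip, trace, mul_apply]

theorem ip_self_nonneg {n : ℕ} (A : Matrix (Fin n) (Fin n) ℂ) : 0 ≤ ip A A := by
  rw [ip_eq]
  exact Finset.sum_nonneg fun _ _ => Finset.sum_nonneg fun _ _ =>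
    add_nonneg (mul_self_nonneg _) (mul_self_nonneg _)

theorem ip_comm {n : ℕ} (A B : Matrix (Fin n) (Fin n) ℂ) : ip A B = ip B A := by
  simp only [ip_eq, mul_comm]

theorem ip_add {n : ℕ} (A B C : Matrix (Fin n) (Fin n) ℂ) : ip A (B + C) = ip A B + ip A C := by
  simp [ip, mul_add, trace_add]

theorem ip_smul {n : ℕ} (A B : Matrix (Fin n) (Fin n) ℂ) (t : ℝ) :
    ip A (t • B) = t * ip A B := by
  simp [ip, trace_smul]

theorem ip_pr {n l : ℕ} {A : Matrix (Fin n) (Fin n) ℂ} (hA : IsPr n l A) : ip A A = l := by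
  rw [ip, hA.1, hA.2.1, hA.2.2]; simp

theorem ip_I {n : ℕ} (A : Matrix (Fin n) (Fin n) ℂ) :
    ip (Complex.I • A) (Complex.I • A) = ip A A := by
  rw [ip_eq, ip_eq]
  refine Finset.sum_congr rfl fun _ _ => Finset.sum_congr rfl fun _ _ => ?_
  simp
  ring

/-- The defect form `ip (L A) (L B) - ip A B` as a real bilinear form. -/
def defect {n : ℕ} (L : Matrix (Fin n) (Fin n) ℂ →ₗ[ℂ] Matrix (Fin n) (Fin n) ℂ) :
    Matrix (Fin n) (Fin n) ℂ →ₗ[ℝ] Matrix (Fin n) (Fin n) ℂ →ₗ[ℝ] ℝ :=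
  LinearMap.mk₂ ℝ (fun A B => ip (L A) (L B) - ip A B)
    (fun A B C => by
      simp only [map_add]
      rw [ip_comm _ (L C), ip_comm _ C, ip_add, ip_add, ip_comm _ (L A), ip_comm _ (L B),
        ip_comm _ A, ip_comm _ B]; ring)
    (fun t A B => by
      rw [LinearMap.map_smul_of_tower, ip_comm _ (L B), ip_comm _ B, ip_smul, ip_smul,
        ip_comm _ (L A), ip_comm _ A, smul_eq_mul]; ring)
    (fun A B C => by simp only [map_add]; rw [ip_add, ip_add]; ring)
    (fun t A B => by
      rw [LinearMap.map_smul_of_tower, ip_smul, ip_smul, smul_eq_mul]; ring)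

theorem defect_apply {n : ℕ} (L : Matrix (Fin n) (Fin n) ℂ →ₗ[ℂ] Matrix (Fin n) (Fin n) ℂ)
    (A B : Matrix (Fin n) (Fin n) ℂ) : defect L A B = ip (L A) (L B) - ip A B := rfl

theorem defect_comm {n : ℕ} (L : Matrix (Fin n) (Fin n) ℂ →ₗ[ℂ] Matrix (Fin n) (Fin n) ℂ)
    (A B : Matrix (Fin n) (Fin n) ℂ) : defect L A B = defect L B A := by
  rw [defect_apply, defect_apply, ip_comm, ip_comm A]

theorem defect_I {n : ℕ} (L : Matrix (Fin n) (Fin n) ℂ →ₗ[ℂ] Matrix (Fin n) (Fin n) ℂ)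
    (A : Matrix (Fin n) (Fin n) ℂ) :
    defect L (Complex.I • A) (Complex.I • A) = defect L A A := by
  rw [defect_apply, defect_apply, map_smul, ip_I, ip_I]

theorem defect_sum_le {n l : ℕ} (hl1 : 1 ≤ l) (hln : l < n)
    (L : Matrix (Fin n) (Fin n) ℂ →ₗ[ℂ] Matrix (Fin n) (Fin n) ℂ)
    (hL : ∀ A, IsPr n l A → IsPr n l (L A)) :
    ∑ i, ∑ j, defect L (single i j 1) (single i j 1) ≤ 0 := by
  have hz : ∀ A, IsPr n l A → defect L A A = 0 := by
    intro A hA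
    rw [defect_apply, ip_pr hA, ip_pr (hL A hA), sub_self]
  set b : Fin n → Fin n → ℝ := fun i j => defect L (single i i 1) (single j j 1) with hb
  have hone : (∑ i, single i i 1 : Matrix (Fin n) (Fin n) ℂ) = 1 := by
    have := isPr_diag (Finset.univ : Finset (Fin n))
    ext a c
    simp only [Matrix.sum_apply, single_apply, one_apply]
    rcases eq_or_ne a c with rfl | hac
    · simp
    · rw [if_neg hac]
      apply Finset.sum_eq_zero
      intro i _
      rw [if_neg]
      rintro ⟨rfl, rfl⟩
      exact hac rfl
  have htot' : ∑ i, ∑ j, b i j = defect L 1 1 := by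
    rw [← hone]
    simp only [map_sum, LinearMap.sum_apply, hb]
    rw [Finset.sum_comm]
  have htot : 0 ≤ ∑ i, ∑ j, b i j := by
    rw [htot', defect_apply]
    have h1 : ip (1 : Matrix (Fin n) (Fin n) ℂ) 1 = n := by simp [ip]
    have h2 : ip 1 (L 1) = n := by
      rw [ip, conjTranspose_one, one_mul, trace_pres hl1 hln L hL]; simp
    have h3 := ip_self_nonneg (L 1 + (-1 : ℝ) • 1)
    rw [ip_add, ip_smul, ip_comm _ (L 1), ip_comm _ 1, ip_add, ip_add, ip_smul, ip_smul,
      ip_comm (L 1) 1, h1, h2] at h3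
    linarith
  have hdiag : ∑ i, b i i ≤ 0 := by
    apply comb_sum hl1 hln b _ htot
    intro S hS
    have := hz _ (hS ▸ isPr_diag S)
    simp only [map_sum, LinearMap.sum_apply] at this
    rw [Finset.sum_comm]
    exact this
  have hpair : ∀ i j, i ≠ j →
      defect L (single i j 1) (single i j 1) + defect L (single j i 1) (single j i 1)
      = b i i + b j j - b i j - b j i := by
    intro i j hij
    obtain ⟨S, hi, hj, hc⟩ := exists_avoid hl1 hln i j hij
    set Q : Matrix (Fin n) (Fin n) ℂ := ∑ k ∈ S, single k k (1 : ℂ) +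
      (1 / 2 : ℝ) • (single i i 1 + single j j 1) with hQ
    have key : ∀ X : Matrix (Fin n) (Fin n) ℂ, IsPr n l (Q + (1 / 2 : ℝ) • X) →
        IsPr n l (Q - (1 / 2 : ℝ) • X) → defect L X X = -4 * defect L Q Q := by
      intro X h1 h2
      have h1 := hz _ h1
      have h2 := hz _ h2
      simp only [map_add, map_sub, LinearMap.add_apply, LinearMap.sub_apply, map_smul,
        LinearMap.smul_apply, smul_eq_mul] at h1 h2
      linarith
    have kz : ∀ z : ℂ, star z * z = 1 →
        defect L (z • single i j 1 + star z • single j i 1)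
          (z • single i j 1 + star z • single j i 1) = -4 * defect L Q Q := by
      intro z hz
      apply key
      · convert hc ▸ isPr_rot_add S i j hi hj hij z hz using 1
        rw [hQ, ← Complex.coe_smul, ← Complex.coe_smul]
        push_cast
        module
      · convert hc ▸ isPr_rot_add S i j hi hj hij (-z) (by simpa using hz) using 1
        rw [hQ, ← Complex.coe_smul, ← Complex.coe_smul, star_neg]
        push_cast
        module
    have k1 := kz 1 (by simp)
    have k2 := kz Complex.I (by simp)
    have k3 : defect L (single i i 1 - single j j 1) (single i i 1 - single j j 1)
        = -4 * defect L Q Q := by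
      apply key
      · convert hc ▸ (Finset.card_insert_of_notMem hi) ▸ isPr_diag (insert i S) using 1
        rw [hQ, Finset.sum_insert hi]
        module
      · convert hc ▸ (Finset.card_insert_of_notMem hj) ▸ isPr_diag (insert j S) using 1
        rw [hQ, Finset.sum_insert hj]
        module
    rw [show Complex.I • single i j 1 + star Complex.I • single j i 1
      = Complex.I • (single i j 1 - single j i (1 : ℂ)) by
        rw [show star Complex.I = - Complex.I from Complex.conj_I]; module, defect_I] at k2
    rw [star_one, one_smul, one_smul] at k1
    simp only [map_add, map_sub, LinearMap.add_apply, LinearMap.sub_apply] at k1 k2 k3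
    simp only [hb]
    linarith
  have hsum : ∑ i, ∑ j, (defect L (single i j 1) (single i j 1) +
      defect L (single j i 1) (single j i 1))
      = ∑ i, ∑ j, (b i i + b j j - b i j - b j i + if i = j then 2 * b i i else 0) := by
    refine Finset.sum_congr rfl fun i _ => Finset.sum_congr rfl fun j _ => ?_
    split_ifs with h
    · subst h; simp only [hb]; ring
    · rw [hpair i j h]; ring
  simp only [Finset.sum_add_distrib, Finset.sum_sub_distrib] at hsum
  rw [Finset.sum_comm (f := fun i j => defect L (single j i 1) (single j i 1)),
    Finset.sum_comm (f := fun i j => b j i)] at hsum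
  simp only [Finset.sum_const, Finset.card_univ, Fintype.card_fin, nsmul_eq_mul, ← Finset.mul_sum,
    Finset.sum_ite_eq, Finset.mem_univ, if_true] at hsum
  have hn : (0 : ℝ) ≤ n := by positivity
  have := mul_nonpos_of_nonneg_of_nonpos hn hdiag
  linarith

/-- Matrix of a linear map on matrices, with respect to the matrix units. -/
def mat {n : ℕ} (L : Matrix (Fin n) (Fin n) ℂ →ₗ[ℂ] Matrix (Fin n) (Fin n) ℂ) :
    Matrix (Fin n × Fin n) (Fin n × Fin n) ℂ :=
  Matrix.of fun p q => L (single q.1 q.2 1) p.1 p.2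

theorem mat_apply_sum {n : ℕ} (L : Matrix (Fin n) (Fin n) ℂ →ₗ[ℂ] Matrix (Fin n) (Fin n) ℂ)
    (A : Matrix (Fin n) (Fin n) ℂ) (p : Fin n × Fin n) :
    ∑ q : Fin n × Fin n, mat L p q * A q.1 q.2 = L A p.1 p.2 := by
  conv_rhs => rw [matrix_eq_sum_single A]
  rw [Fintype.sum_prod_type]
  simp only [map_sum, Matrix.sum_apply]
  refine Finset.sum_congr rfl fun i _ => Finset.sum_congr rfl fun j _ => ?_
  have : single i j (A i j) = A i j • single i j (1 : ℂ) := by simp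
  rw [this, map_smul, Matrix.smul_apply, smul_eq_mul, mul_comm]
  rfl

theorem mat_mul {n : ℕ} (L K : Matrix (Fin n) (Fin n) ℂ →ₗ[ℂ] Matrix (Fin n) (Fin n) ℂ)
    (h : ∀ A, L (K A) = A) : mat L * mat K = 1 := by
  ext p q
  rw [mul_apply]
  have := mat_apply_sum L (K (single q.1 q.2 1)) p
  rw [h] at this
  refine Eq.trans this ?_
  rw [single_apply, one_apply]
  congr 1
  rw [Prod.ext_iff, eq_comm (a := q.1), eq_comm (a := q.2)]

theorem trace_mat {n : ℕ} (L : Matrix (Fin n) (Fin n) ℂ →ₗ[ℂ] Matrix (Fin n) (Fin n) ℂ) :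
    ((mat L)ᴴ * mat L).trace.re = ∑ i, ∑ j, ip (L (single i j 1)) (L (single i j 1)) := by
  rw [trace, Fintype.sum_prod_type, Complex.re_sum]
  refine Finset.sum_congr rfl fun i _ => ?_
  rw [Complex.re_sum]
  refine Finset.sum_congr rfl fun j _ => ?_
  rw [diag_apply, mul_apply, Fintype.sum_prod_type_right, ip_eq]
  simp [mat]

theorem trace_mat_le {n l : ℕ} (hl1 : 1 ≤ l) (hln : l < n)
    (L : Matrix (Fin n) (Fin n) ℂ →ₗ[ℂ] Matrix (Fin n) (Fin n) ℂ)
    (hL : ∀ A, IsPr n l A → IsPr n l (L A)) :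
    ((mat L)ᴴ * mat L).trace.re ≤ n * n := by
  rw [trace_mat]
  have h := defect_sum_le hl1 hln L hL
  simp only [defect_apply, Finset.sum_sub_distrib] at h
  have h2 : ∀ i j : Fin n, ip (single i j (1 : ℂ)) (single i j 1) = 1 := by
    intro i j
    simp [ip]
  simp only [h2] at h
  simp at h
  linarith

open scoped ComplexOrder in
theorem mat_unitary {n l : ℕ} (hl1 : 1 ≤ l) (hln : l < n)
    (L K : Matrix (Fin n) (Fin n) ℂ →ₗ[ℂ] Matrix (Fin n) (Fin n) ℂ)
    (hL : ∀ A, IsPr n l A → IsPr n l (L A)) (hK : ∀ A, IsPr n l A → IsPr n l (K A))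
    (hLK : ∀ A, L (K A) = A) : (mat L)ᴴ * mat L = 1 := by
  have h1 := mat_mul L K hLK
  have h2 : mat K * mat L = 1 := mul_eq_one_comm.mp h1
  have hl := trace_mat_le hl1 hln L hL
  have hk := trace_mat_le hl1 hln K hK
  set X := mat L - (mat K)ᴴ with hX
  have hexp : Xᴴ * X = (mat L)ᴴ * mat L - 1 - 1 + mat K * (mat K)ᴴ := by
    rw [hX, conjTranspose_sub, conjTranspose_conjTranspose, sub_mul, mul_sub, mul_sub,
      ← conjTranspose_mul, h2, conjTranspose_one]
    abel
  have htr : (Xᴴ * X).trace.re ≤ 0 := by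
    rw [hexp, trace_add, trace_sub, trace_sub, trace_mul_comm (mat K), trace_one]
    simp only [Complex.add_re, Complex.sub_re, Fintype.card_prod, Fintype.card_fin, Nat.cast_mul]
    simp
    linarith
  have hnn : 0 ≤ (Xᴴ * X).trace := (posSemidef_conjTranspose_mul_self X).trace_nonneg
  have hX0 : X = 0 := by
    rw [← trace_conjTranspose_mul_self_eq_zero_iff]
    rw [Complex.le_def] at hnn
    apply Complex.ext
    · exact le_antisymm htr hnn.1
    · exact hnn.2.symm
  have : mat L = (mat K)ᴴ := sub_eq_zero.mp hX0
  rw [show (mat L)ᴴ = mat K by rw [this, conjTranspose_conjTranspose], h2]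

theorem trace_as_dot {n : ℕ} (A B : Matrix (Fin n) (Fin n) ℂ) :
    (Aᴴ * B).trace = star (fun p : Fin n × Fin n => A p.1 p.2) ⬝ᵥ (fun p => B p.1 p.2) := by
  simp [trace, mul_apply, dotProduct, Fintype.sum_prod_type_right]

theorem isometry_of {n l : ℕ} (hl1 : 1 ≤ l) (hln : l < n)
    (L K : Matrix (Fin n) (Fin n) ℂ →ₗ[ℂ] Matrix (Fin n) (Fin n) ℂ)
    (hL : ∀ A, IsPr n l A → IsPr n l (L A)) (hK : ∀ A, IsPr n l A → IsPr n l (K A))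
    (hLK : ∀ A, L (K A) = A) (A B : Matrix (Fin n) (Fin n) ℂ) :
    ((L A)ᴴ * L B).trace = (Aᴴ * B).trace := by
  have hu := mat_unitary hl1 hln L K hL hK hLK
  have hv : ∀ A, (fun p : Fin n × Fin n => L A p.1 p.2)
      = mat L *ᵥ (fun p : Fin n × Fin n => A p.1 p.2) := by
    intro A
    ext p
    exact (mat_apply_sum L A p).symm
  rw [trace_as_dot, trace_as_dot, hv, hv, star_mulVec, ← dotProduct_mulVec, mulVec_mulVec, hu,
    one_mulVec]

theorem map_one_of {n l : ℕ} (hl1 : 1 ≤ l) (hln : l < n)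
    (L K : Matrix (Fin n) (Fin n) ℂ →ₗ[ℂ] Matrix (Fin n) (Fin n) ℂ)
    (hL : ∀ A, IsPr n l A → IsPr n l (L A)) (hK : ∀ A, IsPr n l A → IsPr n l (K A))
    (hLK : ∀ A, L (K A) = A) : L 1 = 1 := by
  have h : ∀ B, (B * (L 1 - 1)).trace = 0 := by
    intro B
    have h1 := isometry_of hl1 hln L K hL hK hLK (K Bᴴ) 1
    rw [hLK, conjTranspose_conjTranspose, mul_one, trace_conjTranspose,
      trace_pres hl1 hln K hK, trace_conjTranspose, star_star] at h1
    rw [mul_sub, trace_sub, h1, mul_one, sub_self]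
  have h0 : L 1 - 1 = 0 := by
    ext i j
    have := h (single j i 1)
    rw [trace_mul_comm] at this
    simpa [trace_mul_single] using this
  exact sub_eq_zero.mp h0

open scoped ComplexOrder in
theorem maps_mul {n l : ℕ} (hl1 : 1 ≤ l) (hln : l < n)
    (L K : Matrix (Fin n) (Fin n) ℂ →ₗ[ℂ] Matrix (Fin n) (Fin n) ℂ)
    (hL : ∀ A, IsPr n l A → IsPr n l (L A)) (hK : ∀ A, IsPr n l A → IsPr n l (K A))
    (hLK : ∀ A, L (K A) = A) (m : ℕ) : ∀ A, IsPr n (l * m) A → IsPr n (l * m) (L A) := by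
  induction m with
  | zero =>
    intro A hA
    have h0 : A = 0 := by
      rw [← trace_conjTranspose_mul_self_eq_zero_iff, hA.1, hA.2.1, hA.2.2]
      simp
    rw [h0, map_zero]
    exact h0 ▸ hA
  | succ m ih =>
    intro A hA
    obtain ⟨B, C, hB, hC, rfl, hBC⟩ := split_pr (a := l * m) (b := l) (by rwa [mul_add, mul_one] at hA)
    rw [map_add, mul_add, mul_one]
    apply pr_add (ih B hB) (hL C hC)
    have := isometry_of hl1 hln L K hL hK hLK B C
    rwa [hB.1, (ih B hB).1, hBC] at this

theorem maps_mod {n l : ℕ} (hl1 : 1 ≤ l) (hln : l < n)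
    (L K : Matrix (Fin n) (Fin n) ℂ →ₗ[ℂ] Matrix (Fin n) (Fin n) ℂ)
    (hL : ∀ A, IsPr n l A → IsPr n l (L A)) (hK : ∀ A, IsPr n l A → IsPr n l (K A))
    (hLK : ∀ A, L (K A) = A) (A : Matrix (Fin n) (Fin n) ℂ) (hA : IsPr n (n % l) A) :
    IsPr n (n % l) (L A) := by
  have h1 : n % l + l * (n / l) = n := Nat.mod_add_div n l
  have h2 := maps_mul hl1 hln L K hL hK hLK (n / l) _ (pr_compl h1 hA)
  rw [map_sub, map_one_of hl1 hln L K hL hK hLK] at h2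
  have h3 := pr_compl (by omega : l * (n / l) + n % l = n) h2
  rwa [sub_sub_cancel] at h3

open scoped ComplexStarModule in
/-- The complex-linear extension of a real-linear map on Hermitian matrices. -/
def cext {n : ℕ} (Φ : BH n →ₗ[ℝ] BH n) :
    Matrix (Fin n) (Fin n) ℂ →ₗ[ℂ] Matrix (Fin n) (Fin n) ℂ where
  toFun A := (Φ (ℜ A) : Matrix (Fin n) (Fin n) ℂ) + Complex.I • (Φ (ℑ A) : Matrix (Fin n) (Fin n) ℂ)
  map_add' A B := by
    simp only [map_add, AddSubgroup.coe_add, smul_add]; abel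
  map_smul' c A := by
    have h1 : ℜ (c • A) = c.re • ℜ A - c.im • ℑ A := realPart_smul c A
    have h2 : ℑ (c • A) = c.re • ℑ A + c.im • ℜ A := imaginaryPart_smul c A
    rw [h1, h2]
    simp only [map_add, map_sub, map_smul, AddSubgroup.coe_add, AddSubgroup.coe_sub,
      selfAdjoint.val_smul, RingHom.id_apply, ← Complex.coe_smul, smul_add, smul_smul]
    conv_rhs => rw [← Complex.re_add_im c]
    match_scalars
    · ring
    · linear_combination (-(c.im : ℂ)) * Complex.I_mul_I

theorem cext_coe {n : ℕ} (Φ : BH n →ₗ[ℝ] BH n) (X : BH n) :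
    cext Φ (X : Matrix (Fin n) (Fin n) ℂ) = Φ X := by
  simp [cext]

open scoped ComplexStarModule in
theorem cext_apply {n : ℕ} (Φ : BH n →ₗ[ℝ] BH n) (A : Matrix (Fin n) (Fin n) ℂ) :
    cext Φ A = (Φ (ℜ A) : Matrix (Fin n) (Fin n) ℂ)
      + Complex.I • (Φ (ℑ A) : Matrix (Fin n) (Fin n) ℂ) := rfl

open scoped ComplexStarModule in
theorem cext_comp {n : ℕ} (Φ Θ : BH n →ₗ[ℝ] BH n) (h : ∀ X, Φ (Θ X) = X)
    (A : Matrix (Fin n) (Fin n) ℂ) : cext Φ (cext Θ A) = A := by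
  rw [cext_apply Θ, map_add, map_smul, cext_coe, cext_coe, h, h, realPart_add_I_smul_imaginaryPart]

theorem cext_isPr {n l : ℕ} (Φ : BH n →ₗ[ℝ] BH n)
    (h : Set.MapsTo Φ (projSet n l) (projSet n l)) (A : Matrix (Fin n) (Fin n) ℂ)
    (hA : IsPr n l A) : IsPr n l (cext Φ A) := by
  have h1 := h ((mem_projSet_iff (⟨A, hA.1⟩ : BH n)).mpr hA)
  rw [mem_projSet_iff, ← cext_coe] at h1
  exact h1

theorem mapsTo_mod {n l : ℕ} (hl1 : 1 ≤ l) (hln : l < n) (Φ Θ : BH n →ₗ[ℝ] BH n)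
    (hΦ : Set.MapsTo Φ (projSet n l) (projSet n l))
    (hΘ : Set.MapsTo Θ (projSet n l) (projSet n l))
    (h : ∀ X, Φ (Θ X) = X) :
    Set.MapsTo Φ (projSet n (n % l)) (projSet n (n % l)) := by
  intro X hX
  rw [mem_projSet_iff] at hX ⊢
  rw [← cext_coe]
  exact maps_mod hl1 hln (cext Φ) (cext Θ) (cext_isPr Φ hΦ) (cext_isPr Θ hΘ) (cext_comp Φ Θ h) _ hX

open scoped ComplexStarModule in
theorem bij_of {n l : ℕ} (hl1 : 1 ≤ l) (hln : l < n) (Φ : BH n →ₗ[ℝ] BH n)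
    (hΦ : Set.SurjOn Φ (projSet n l) (projSet n l)) : Function.Bijective Φ := by
  have hs : Function.Surjective (cext Φ) := by
    rw [← LinearMap.range_eq_top, eq_top_iff, ← span_pr hl1 hln, Submodule.span_le]
    intro A hA
    obtain ⟨X, -, hX⟩ := hΦ ((mem_projSet_iff (⟨A, hA.1⟩ : BH n)).mpr hA)
    exact ⟨X, by rw [cext_coe, hX]⟩
  have hi : Function.Injective (cext Φ) := LinearMap.injective_iff_surjective.mpr hs
  constructor
  · intro X Y hXY
    apply Subtype.ext
    apply hi
    rw [cext_coe, cext_coe, hXY]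
  · intro Y
    obtain ⟨B, hB⟩ := hs (Y : Matrix (Fin n) (Fin n) ℂ)
    refine ⟨ℜ B, ?_⟩
    have := congrArg realPart hB
    rw [cext_apply, map_add, realPart_I_smul, selfAdjoint.realPart_coe, selfAdjoint.realPart_coe,
      selfAdjoint.imaginaryPart_coe, neg_zero, add_zero] at this
    exact this

theorem stmt_2 (n l k : ℕ) (hn : 1 ≤ n) (hl1 : 1 ≤ l) (hln : l ≤ n)
    (hk : k = n % l) (hk1 : 1 ≤ k)
    (H : ∀ Ψ : BH n →ₗ[ℝ] BH n,
      Set.BijOn Ψ (projSet n k) (projSet n k) → WignerForm n Ψ)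
    (Φ : BH n →ₗ[ℝ] BH n)
    (hΦ : Set.BijOn Φ (projSet n l) (projSet n l)) :
    WignerForm n Φ := by
  subst hk
  have hlt : l < n := by
    rcases Nat.lt_or_ge l n with h | h
    · exact h
    · have : l = n := le_antisymm hln h
      subst this
      simp at hk1
  have hbij := bij_of hl1 hlt Φ hΦ.surjOn
  let e : BH n ≃ₗ[ℝ] BH n := LinearEquiv.ofBijective Φ hbij
  let Θ : BH n →ₗ[ℝ] BH n := e.symm.toLinearMap
  have h1 : ∀ X, Φ (Θ X) = X := fun X => e.apply_symm_apply X
  have h2 : ∀ X, Θ (Φ X) = X := fun X => e.symm_apply_apply X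
  have hΘ : Set.MapsTo Θ (projSet n l) (projSet n l) := by
    intro Y hY
    obtain ⟨X, hX, rfl⟩ := hΦ.surjOn hY
    rwa [h2]
  apply H
  refine ⟨mapsTo_mod hl1 hlt Φ Θ hΦ.mapsTo hΘ h1, hbij.1.injOn, ?_⟩
  intro Y hY
  exact ⟨Θ Y, mapsTo_mod hl1 hlt Θ Φ hΘ hΦ.mapsTo h2 hY, h1 Y⟩
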